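/- Let G be a social graph, let u and v be adjacent vertices of G such that {u, v} is a dominating set of G (every other vertex is adjacent to u or to v), and suppose the fraction of cliques of G containing u or v is less than 1/2. Then contracting the edge uv yields a graph with strictly more cliques than G, a contradiction; equivalently, in a social graph no such pair u, v exists. -/

import Mathlib

/-- `H` is a minor of `G`: there are disjoint nonempty connected branch sets in `G`,
one for each vertex of `H`, with an edge of `G` between the branch sets of any two
vertices adjacent in `H`. -/
def SimpleGraph.IsMinor {W V : Type*} (H : SimpleGraph W) (G : SimpleGraph V) : Prop :=
  ∃ f : W → Set V,
    (∀ w, (f w).Nonempty) ∧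
    (∀ w, (G.induce (f w)).Connected) ∧
    (Pairwise fun w₁ w₂ => Disjoint (f w₁) (f w₂)) ∧
    ∀ ⦃w₁ w₂⦄, H.Adj w₁ w₂ → ∃ v₁ ∈ f w₁, ∃ v₂ ∈ f w₂, G.Adj v₁ v₂

/-- The number of cliques (vertex subsets inducing complete subgraphs, including `∅`). -/
noncomputable def SimpleGraph.cliqueCount {V : Type*} [Fintype V] (G : SimpleGraph V) : ℕ :=
  Nat.card {s : Finset V // G.IsClique (s : Set V)}

/-- The number of cliques containing a given vertex. -/
noncomputable def SimpleGraph.cliqueCountOn {V : Type*} [Fintype V] (G : SimpleGraph V)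
    (v : V) : ℕ :=
  Nat.card {s : Finset V // G.IsClique (s : Set V) ∧ v ∈ s}

/-- The Hadwiger number: the largest `t` such that `K_t` is a minor of `G`. -/
noncomputable def SimpleGraph.hadwigerNumber {V : Type*} [Fintype V] (G : SimpleGraph V) : ℕ :=
  sSup {t | (completeGraph (Fin t)).IsMinor G}

/-- The matching number: the maximum number of edges of a matching in `G`. -/
noncomputable def SimpleGraph.matchingNumber {V : Type*} [Fintype V] (G : SimpleGraph V) : ℕ :=
  sSup {k | ∃ M : G.Subgraph, M.IsMatching ∧ M.edgeSet.ncard = k}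
/-- The graph obtained from `G` by contracting the edge `uv`: the vertex `v` is removed
and its neighbors are attached to `u`. -/
def SimpleGraph.contractEdge {V : Type*} (G : SimpleGraph V) (u v : V) :
    SimpleGraph {x : V // x ≠ v} where
  Adj x y := x.1 ≠ y.1 ∧
    (G.Adj x.1 y.1 ∨ (x.1 = u ∧ G.Adj v y.1) ∨ (y.1 = u ∧ G.Adj v x.1))
  symm := by
    constructor
    rintro x y ⟨hne, h⟩
    refine ⟨hne.symm, ?_⟩
    rcases h with h | ⟨h1, h2⟩ | ⟨h1, h2⟩
    · exact Or.inl h.symm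
    · exact Or.inr (Or.inr ⟨h1, h2⟩)
    · exact Or.inr (Or.inl ⟨h1, h2⟩)
  loopless := by
    constructor
    rintro x ⟨hne, -⟩
    exact hne rfl

/-- `G` is a social graph: contracting an edge never increases the number of cliques. -/
def SimpleGraph.IsSocial {V : Type*} [Fintype V] [DecidableEq V] (G : SimpleGraph V) : Prop :=
  ∀ u v : V, G.Adj u v → (G.contractEdge u v).cliqueCount ≤ G.cliqueCount

/-- `α* = (2 - √2)/2 - 0.001`. -/
noncomputable def alphaStar : ℝ := (2 - Real.sqrt 2) / 2 - 0.001

/-- If the adjacent pair `u, v` dominates `G`, then each clique `s` of `G` avoiding both gives two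
cliques `s` and `s ∪ {u}` of the graph obtained by contracting `uv`. -/
theorem SimpleGraph.two_mul_card_cliques_avoiding_le_cliqueCount_contractEdge {V : Type*}
    [Fintype V] [DecidableEq V] (G : SimpleGraph V) (u v : V) (huv : G.Adj u v)
    (hdom : ∀ w : V, w = u ∨ w = v ∨ G.Adj u w ∨ G.Adj v w) :
    2 * Nat.card {s : Finset V // G.IsClique (s : Set V) ∧ ¬(u ∈ s ∨ v ∈ s)} ≤
      (G.contractEdge u v).cliqueCount := by
  have h2 : 2 = Nat.card Bool := by simp
  rw [h2, ← Nat.card_prod, SimpleGraph.cliqueCount]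
  let u' : {x : V // x ≠ v} := ⟨u, huv.ne⟩
  have hsub : ∀ s : Finset V, G.IsClique (s : Set V) →
      (G.contractEdge u v).IsClique (s.subtype (· ≠ v) : Set {x : V // x ≠ v}) := by
    intro s hs x hx y hy hxy
    have hxy' : x.1 ≠ y.1 := fun h => hxy (Subtype.ext h)
    exact ⟨hxy', Or.inl (hs (by simpa using hx) (by simpa using hy) hxy')⟩
  have hins : ∀ s : Finset V, G.IsClique (s : Set V) →
      (G.contractEdge u v).IsClique
        (insert u' (s.subtype (· ≠ v)) : Finset {x : V // x ≠ v}) := by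
    intro s hs
    rw [Finset.coe_insert, SimpleGraph.isClique_insert]
    refine ⟨hsub s hs, fun y _ hy => ?_⟩
    have hy' : u ≠ y.1 := fun h => hy (Subtype.ext h)
    refine ⟨hy', ?_⟩
    rcases hdom y.1 with h | h | h | h
    · exact absurd h.symm hy'
    · exact absurd h y.2
    · exact Or.inl h
    · exact Or.inr (Or.inl ⟨rfl, h⟩)
  let f : Bool × {s : Finset V // G.IsClique (s : Set V) ∧ ¬(u ∈ s ∨ v ∈ s)} →
      {t : Finset {x : V // x ≠ v} // (G.contractEdge u v).IsClique (t : Set {x : V // x ≠ v})} :=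
    fun p => match p with
      | (false, s) => ⟨s.1.subtype (· ≠ v), hsub s.1 s.2.1⟩
      | (true, s) => ⟨insert u' (s.1.subtype (· ≠ v)), hins s.1 s.2.1⟩
  have hf_u : ∀ b s, u' ∈ (f (b, s)).1 ↔ b = true := by
    rintro (_ | _) s
    · simpa [f, u'] using fun h => s.2.2 (Or.inl h)
    · simp [f]
  have hf_ne : ∀ b s (x : {x : V // x ≠ v}), x.1 ≠ u → (x ∈ (f (b, s)).1 ↔ x.1 ∈ s.1) := by
    rintro (_ | _) s x hx
    · simp [f]
    · have : x ≠ u' := fun h => hx (congrArg Subtype.val h)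
      simp [f, this]
  refine Nat.card_le_card_of_injective f ?_
  rintro ⟨b, s⟩ ⟨c, t⟩ h
  have hbc : b = c := by
    rw [Bool.eq_iff_iff, ← hf_u b s, ← hf_u c t, h]
  refine Prod.ext hbc (Subtype.ext (Finset.ext fun x => ?_))
  by_cases hxu : x = u
  · subst hxu
    exact iff_of_false (fun h => s.2.2 (Or.inl h)) (fun h => t.2.2 (Or.inl h))
  by_cases hxv : x = v
  · subst hxv
    exact iff_of_false (fun h => s.2.2 (Or.inr h)) (fun h => t.2.2 (Or.inr h))
  exact (hf_ne b s ⟨x, hxv⟩ hxu).symm.trans (by rw [h]; exact hf_ne c t ⟨x, hxv⟩ hxu)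

/-- The cliques of `G` split into those satisfying `p` and those that do not. -/
theorem SimpleGraph.cliqueCount_eq_card_add_card_not {V : Type*} [Fintype V]
    (G : SimpleGraph V) (p : Finset V → Prop) :
    G.cliqueCount = Nat.card {s : Finset V // G.IsClique (s : Set V) ∧ p s} +
      Nat.card {s : Finset V // G.IsClique (s : Set V) ∧ ¬p s} := by
  classical
  simp only [SimpleGraph.cliqueCount, Nat.card_eq_fintype_card, Fintype.card_subtype,
    ← Finset.filter_filter]
  exact (Finset.card_filter_add_card_filter_not p).symm

/-- In a social graph there is no pair of adjacent vertices `u, v` forming a dominating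
set such that the fraction of cliques containing `u` or `v` is less than `1/2`:
contracting such an edge would strictly increase the number of cliques. -/
theorem social_graph_no_dominating_pair_in_few_cliques {V : Type*} [Fintype V]
    [DecidableEq V] (G : SimpleGraph V) (hG : G.IsSocial) (u v : V) (huv : G.Adj u v)
    (hdom : ∀ w : V, w = u ∨ w = v ∨ G.Adj u w ∨ G.Adj v w)
    (hfrac : ((Nat.card {s : Finset V // G.IsClique (s : Set V) ∧ (u ∈ s ∨ v ∈ s)} : ℝ) /
        G.cliqueCount) < 1 / 2) :
    False := by
  have hsplit := G.cliqueCount_eq_card_add_card_not (fun s => u ∈ s ∨ v ∈ s)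
  have hle := (G.two_mul_card_cliques_avoiding_le_cliqueCount_contractEdge u v huv hdom).trans
    (hG u v huv)
  have hpos : 0 < G.cliqueCount := by
    have : Nonempty {s : Finset V // G.IsClique (s : Set V)} := ⟨∅, by simp⟩
    exact Nat.card_pos
  have hpos' : (0 : ℝ) < G.cliqueCount := by exact_mod_cast hpos
  rw [div_lt_div_iff₀ hpos' two_pos] at hfrac
  have hlt : Nat.card {s : Finset V // G.IsClique (s : Set V) ∧ (u ∈ s ∨ v ∈ s)} * 2 <
      1 * G.cliqueCount := by exact_mod_cast hfrac
  omega
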